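/- For every ε > 0, the value iteration algorithm reaches an ε-approximation of the limiting value vector in finitely many iterations: there exists K such that for all k ≥ K and all states s ∈ S, V*(s) − V^(k)(s) ≤ ε, where V*(s) = sup_j V^(j)(s). -/

import Mathlib

open Classical in
/-- The Bellman operator of the APT-DIFT game: `T V s = β` on defender-winning
absorbing states, `0` on adversary-winning absorbing states, and otherwise the
supremum over defender probability vectors of the minimum over adversary
actions of the expected next-state value. -/
noncomputable def bellmanT {S A D : Type*} [Fintype S] [Fintype A] [Fintype D]
    (β : ℝ) (WD WA : Set S) (P : S → A → D → S → ℝ) (V : S → ℝ) (s : S) : ℝ :=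
  if s ∈ WD then β
  else if s ∈ WA then 0
  else sSup ((fun p : D → ℝ => ⨅ a : A, ∑ d : D, ∑ s' : S, p d * P s a d s' * V s') ''
    {p : D → ℝ | (∀ d, 0 ≤ p d) ∧ ∑ d : D, p d = 1})

theorem expectedValue_mono {S D : Type*} [Fintype S] [Fintype D] {p : D → ℝ}
    (hp : ∀ d, 0 ≤ p d) {Q : D → S → ℝ} (hQ : ∀ d s', 0 ≤ Q d s') {V W : S → ℝ} (hVW : V ≤ W) :
    ∑ d : D, ∑ s' : S, p d * Q d s' * V s' ≤ ∑ d : D, ∑ s' : S, p d * Q d s' * W s' :=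
  Finset.sum_le_sum fun d _ => Finset.sum_le_sum fun s' _ =>
    mul_le_mul_of_nonneg_left (hVW s') (mul_nonneg (hp d) (hQ d s'))

theorem expectedValue_const {S D : Type*} [Fintype S] [Fintype D] {p : D → ℝ}
    (hp : ∑ d, p d = 1) {Q : D → S → ℝ} (hQ : ∀ d, ∑ s', Q d s' = 1) (c : ℝ) :
    ∑ d : D, ∑ s' : S, p d * Q d s' * c = c := by
  simp [← Finset.sum_mul, ← Finset.mul_sum, hQ, hp]

section Bellman

variable {S A D : Type*} [Fintype S] [Fintype A] [Fintype D] {β : ℝ} {WD WA : Set S}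
  {P : S → A → D → S → ℝ}

theorem iInf_expectedValue_le [Nonempty A] (hPnonneg : ∀ s a d s', 0 ≤ P s a d s')
    (hPsum : ∀ s a d, ∑ s' : S, P s a d s' = 1) {V : S → ℝ} {c : ℝ} (hV : ∀ s, V s ≤ c) (s : S)
    {p : D → ℝ} (hp : ∀ d, 0 ≤ p d) (hp_sum : ∑ d, p d = 1) :
    ⨅ a : A, ∑ d : D, ∑ s' : S, p d * P s a d s' * V s' ≤ c :=
  (ciInf_le (Set.finite_range _).bddBelow (Classical.arbitrary A)).trans <|
    (expectedValue_mono hp (hPnonneg s _) hV).trans_eq (expectedValue_const hp_sum (hPsum s _) c)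

theorem bellmanT_mono [Nonempty A] [Nonempty D] (hPnonneg : ∀ s a d s', 0 ≤ P s a d s')
    (hPsum : ∀ s a d, ∑ s' : S, P s a d s' = 1) :
    Monotone (bellmanT β WD WA P) := by
  classical
  intro V W hVW s
  unfold bellmanT
  split_ifs
  · exact le_rfl
  · exact le_rfl
  · obtain ⟨c, hc⟩ := (Set.finite_range W).bddAbove
    have hbdd : BddAbove ((fun p : D → ℝ => ⨅ a : A, ∑ d : D, ∑ s' : S, p d * P s a d s' * W s') ''
        {p : D → ℝ | (∀ d, 0 ≤ p d) ∧ ∑ d : D, p d = 1}) := by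
      refine ⟨c, ?_⟩
      rintro _ ⟨p, ⟨hp, hp_sum⟩, rfl⟩
      exact iInf_expectedValue_le hPnonneg hPsum (fun s' => hc ⟨s', rfl⟩) s hp hp_sum
    refine csSup_le ?_ ?_
    · exact ⟨_, Pi.single (Classical.arbitrary D) 1,
        ⟨fun d => by by_cases h : d = Classical.arbitrary D <;> simp [h],
          by simp⟩, rfl⟩
    · rintro _ ⟨p, hp, rfl⟩
      exact (ciInf_mono (Set.finite_range _).bddBelow fun a =>
        expectedValue_mono hp.1 (hPnonneg s a) hVW).trans (le_csSup hbdd ⟨p, hp, rfl⟩)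

theorem bellmanT_nonneg (hβ : 0 ≤ β) (hPnonneg : ∀ s a d s', 0 ≤ P s a d s') {V : S → ℝ}
    (hV : ∀ s, 0 ≤ V s) (s : S) : 0 ≤ bellmanT β WD WA P V s := by
  unfold bellmanT
  split_ifs
  · exact hβ
  · exact le_rfl
  · refine Real.sSup_nonneg ?_
    rintro _ ⟨p, hp, rfl⟩
    exact Real.iInf_nonneg fun a => Finset.sum_nonneg fun d _ => Finset.sum_nonneg fun s' _ =>
      mul_nonneg (mul_nonneg (hp.1 d) (hPnonneg s a d s')) (hV s')

theorem bellmanT_le [Nonempty A] (hβ : 0 ≤ β) (hPnonneg : ∀ s a d s', 0 ≤ P s a d s')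
    (hPsum : ∀ s a d, ∑ s' : S, P s a d s' = 1) {V : S → ℝ} (hV : ∀ s, V s ≤ β) (s : S) :
    bellmanT β WD WA P V s ≤ β := by
  unfold bellmanT
  split_ifs
  · exact le_rfl
  · exact hβ
  · refine Real.sSup_le ?_ hβ
    rintro _ ⟨p, hp, rfl⟩
    exact iInf_expectedValue_le hPnonneg hPsum hV s hp.1 hp.2

end Bellman

/-- For every `ε > 0`, value iteration reaches an `ε`-approximation of the
limiting value vector in finitely many iterations: there exists `K` such that
for all `k ≥ K` and all states `s`, `V* s - V k s ≤ ε` where `V* s = ⨆ j, V j s`. -/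
theorem value_iteration_eps_approx {S A D : Type*} [Fintype S] [Fintype A] [Fintype D]
    [Nonempty A] [Nonempty D]
    (β : ℝ) (hβ : 0 ≤ β) (WD WA : Set S) (hdisj : Disjoint WD WA)
    (P : S → A → D → S → ℝ)
    (hPnonneg : ∀ s a d s', 0 ≤ P s a d s')
    (hPsum : ∀ s a d, ∑ s' : S, P s a d s' = 1)
    (V : ℕ → S → ℝ)
    (hV0 : V 0 = fun _ => 0)
    (hVsucc : ∀ k, V (k + 1) = bellmanT β WD WA P (V k)) :
    ∀ ε : ℝ, 0 < ε → ∃ K : ℕ, ∀ k ≥ K, ∀ s : S, (⨆ j, V j s) - V k s ≤ ε := by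
  have hmono : Monotone V := monotone_nat_of_le_succ fun k => by
    induction k with
    | zero =>
      intro s
      rw [hVsucc 0, hV0]
      exact bellmanT_nonneg hβ hPnonneg (fun _ => le_rfl) s
    | succ k ih =>
      rw [hVsucc (k + 1)]
      exact (hVsucc k).trans_le (bellmanT_mono hPnonneg hPsum ih)
  have hle : ∀ k s, V k s ≤ β := fun k => by
    induction k with
    | zero => simpa [hV0] using fun _ => hβ
    | succ k ih =>
      rw [hVsucc k]
      exact bellmanT_le hβ hPnonneg hPsum ih
  intro ε hε
  have hconv : ∀ᶠ k in Filter.atTop, ∀ s, (⨆ j, V j s) - V k s ≤ ε :=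
    Filter.eventually_all.2 fun s => by
      have hlim := tendsto_atTop_ciSup (fun i j hij => hmono hij s : Monotone fun j => V j s)
        ⟨β, Set.forall_mem_range.2 fun k => hle k s⟩
      filter_upwards [hlim.eventually_const_lt (sub_lt_self _ hε)] with k hk
      linarith
  exact Filter.eventually_atTop.1 hconv
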